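/- There do not exist: a complex polynomial p with deg(p) = d ≥ 2, an integer r ≥ 2, pairwise disjoint nonempty bounded simply connected open sets V₁, …, V_r ⊆ ℂ, and a permutation σ of {1,…,r}, such that p⁻¹(V_{σ(j)}) = V_j for every j = 1,…,r. -/

import Mathlib

open Polynomial

section Helpers

open Set Filter Topology

/-- `z ↦ z - q` admits a continuous logarithm on `S`. -/
def HasContinuousLog (S : Set ℂ) (q : ℂ) : Prop :=
  ∃ h : ℂ → ℂ, ContinuousOn h S ∧ ∀ z ∈ S, Complex.exp (h z) = z - q

namespace HasContinuousLog

lemma mono {S T : Set ℂ} {q : ℂ} (h : HasContinuousLog T q) (hST : S ⊆ T) :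
    HasContinuousLog S q :=
  let ⟨g, hg, hg'⟩ := h
  ⟨g, hg.mono hST, fun z hz => hg' z (hST hz)⟩

lemma of_isSimplyConnected {V : Set ℂ} (hV : IsSimplyConnected V) (hVo : IsOpen V) {q : ℂ}
    (hq : q ∉ V) : HasContinuousLog V q := by
  obtain ⟨f, hf, hf'⟩ := Complex.exists_continuousOn_eqOn_exp_comp hV hVo
    (g := fun z => z - q) (by fun_prop) (by
      rintro ⟨z, hz, h⟩
      exact hq (sub_eq_zero.1 h ▸ hz))
  exact ⟨f, hf, fun z hz => hf' hz⟩

lemma of_div_mem_slitPlane {S : Set ℂ} {q w : ℂ} (hw : w ≠ 0)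
    (h : ∀ z ∈ S, (z - q) / w ∈ Complex.slitPlane) : HasContinuousLog S q := by
  refine ⟨fun z => Complex.log ((z - q) / w) + Complex.log w, ?_, fun z hz => ?_⟩
  · exact ContinuousOn.add (ContinuousOn.clog (by fun_prop) h) continuousOn_const
  · rw [Complex.exp_add, Complex.exp_log (Complex.slitPlane_ne_zero (h z hz)),
      Complex.exp_log hw, div_mul_cancel₀ _ hw]

lemma of_near {S : Set ℂ} {x y : ℂ} (h : HasContinuousLog S x)
    (hxy : ∀ z ∈ S, ‖x - y‖ < ‖z - x‖) : HasContinuousLog S y := by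
  obtain ⟨g, hg, hg'⟩ := h
  have hne : ∀ z ∈ S, z - x ≠ 0 := fun z hz h0 => by
    have := hxy z hz
    rw [h0, norm_zero] at this
    exact absurd this (not_lt.2 (norm_nonneg _))
  have hsl : ∀ z ∈ S, 1 + (x - y) / (z - x) ∈ Complex.slitPlane := fun z hz => by
    apply Complex.mem_slitPlane_of_norm_lt_one
    rw [norm_div, div_lt_one (norm_pos_iff.2 (hne z hz))]
    exact hxy z hz
  refine ⟨fun z => g z + Complex.log (1 + (x - y) / (z - x)), ?_, fun z hz => ?_⟩
  · refine hg.add (ContinuousOn.clog ?_ hsl)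
    exact continuousOn_const.add (continuousOn_const.div (by fun_prop) hne)
  · rw [Complex.exp_add, Complex.exp_log (Complex.slitPlane_ne_zero (hsl z hz)), hg' z hz]
    field_simp [hne z hz]
    ring

lemma of_isPreconnected {S T : Set ℂ} (hS : IsClosed S) (hT : IsPreconnected T)
    (hST : Disjoint S T) {x y : ℂ} (hx : x ∈ T) (hy : y ∈ T) (h : HasContinuousLog S x) :
    HasContinuousLog S y := by
  have key : HasContinuousLog S x ↔ HasContinuousLog S y := by
    refine hT.induction₂ (fun x y => HasContinuousLog S x ↔ HasContinuousLog S y) ?_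
      (fun x y z _ _ _ h₁ h₂ => h₁.trans h₂) (fun x y _ _ h => h.symm) hx hy
    intro x hx
    have hxS : x ∈ Sᶜ := fun h => hST.le_bot ⟨h, hx⟩
    obtain ⟨r, hr, hrS⟩ := Metric.isOpen_iff.1 hS.isOpen_compl x hxS
    have hd : ∀ z ∈ S, r ≤ ‖z - x‖ := fun z hz => by
      by_contra! hlt
      exact hrS (by simpa [dist_eq_norm] using hlt) hz
    filter_upwards [mem_nhdsWithin_of_mem_nhds (Metric.ball_mem_nhds x (half_pos hr))] with y hy
    rw [Metric.mem_ball, dist_eq_norm] at hy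
    refine ⟨fun h => h.of_near fun z hz => ?_, fun h => h.of_near fun z hz => ?_⟩
    · rw [norm_sub_rev x y]
      linarith [hd z hz]
    · have := hd z hz
      have h3 : ‖z - x‖ ≤ ‖z - y‖ + ‖y - x‖ := norm_sub_le_norm_sub_add_norm_sub z y x
      linarith
  exact key.1 h

lemma of_norm_lt {S : Set ℂ} {q : ℂ} (h : ∀ z ∈ S, ‖z‖ < ‖q‖) (hq : q ≠ 0) :
    HasContinuousLog S q := by
  refine of_div_mem_slitPlane (neg_ne_zero.2 hq) fun z hz => ?_
  have : (z - q) / -q = 1 + -(z / q) := by field_simp; ring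
  rw [this]
  apply Complex.mem_slitPlane_of_norm_lt_one
  rw [norm_neg, norm_div, div_lt_one (norm_pos_iff.2 hq)]
  exact h z hz

lemma union {S T : Set ℂ} (hS : IsClosed S) (hT : IsClosed T) {k q : ℂ} (hk : S ∩ T = {k})
    (h₁ : HasContinuousLog S q) (h₂ : HasContinuousLog T q) : HasContinuousLog (S ∪ T) q := by
  classical
  obtain ⟨g, hg, hg'⟩ := h₁
  obtain ⟨h, hh, hh'⟩ := h₂
  have hkS : k ∈ S ∩ T := by simp [hk]
  have hc : Complex.exp (g k - h k) = 1 := by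
    rw [Complex.exp_sub, hg' k hkS.1, ← hh' k hkS.2, div_self (Complex.exp_ne_zero _)]
  set F : ℂ → ℂ := fun z => if z ∈ S then g z else h z + (g k - h k)
  have hFS : EqOn F g S := fun z hz => if_pos hz
  have hFT : EqOn F (fun z => h z + (g k - h k)) T := fun z hz => by
    by_cases hzS : z ∈ S
    · have : z = k := mem_singleton_iff.1 (hk ▸ ⟨hzS, hz⟩)
      subst this
      simp [F, hzS]
    · exact if_neg hzS
  refine ⟨F, (hg.congr hFS).union_of_isClosed ((hh.add continuousOn_const).congr hFT) hS hT, ?_⟩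
  rintro z (hz | hz)
  · rw [hFS hz, hg' z hz]
  · rw [hFT hz, Complex.exp_add, hc, mul_one, hh' z hz]

end HasContinuousLog

lemma eq_of_exp_eq_one {M : Set ℂ} (hM : IsPreconnected M) {k : ℂ → ℂ} (hk : ContinuousOn k M)
    (h1 : ∀ z ∈ M, Complex.exp (k z) = 1) {x y : ℂ} (hx : x ∈ M) (hy : y ∈ M) : k x = k y := by
  refine hM.induction₂ (fun x y => k x = k y) ?_
      (fun x y z _ _ _ h₁ h₂ => h₁.trans h₂) (fun x y _ _ h => h.symm) hx hy
  intro x hx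
  have := (hk x hx) (Metric.ball_mem_nhds (k x) one_pos)
  filter_upwards [this, self_mem_nhdsWithin] with y hy hyM
  have he : Complex.exp (k y - k x) = 1 := by
    rw [Complex.exp_sub, h1 x hx, h1 y hyM, div_one]
  obtain ⟨m, hm⟩ := Complex.exp_eq_one_iff.1 he
  have hy' : ‖k y - k x‖ < 1 := by simpa [dist_eq_norm] using hy
  have hm0 : m = 0 := by
    by_contra hm0
    have h2 : (1 : ℝ) ≤ |(m : ℝ)| := by exact_mod_cast Int.one_le_abs hm0
    rw [hm] at hy'
    simp only [norm_mul, Complex.norm_intCast, Complex.norm_ofNat, Complex.norm_real,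
      Complex.norm_I, mul_one, Real.norm_eq_abs, abs_of_pos Real.pi_pos] at hy'
    nlinarith [Real.pi_gt_three]
  rw [hm0] at hm
  simp only [Int.cast_zero, zero_mul] at hm
  exact (sub_eq_zero.1 hm).symm

/-- A circle around `q` carries no continuous logarithm of `z - q`. -/
lemma not_exp_eq_on_sphere {q : ℂ} {R : ℝ} (hR : 0 < R) {g : ℂ → ℂ} (hg : Continuous g) :
    ¬ ∀ z, ‖z - q‖ = R → Complex.exp (g z) = z - q := by
  intro h
  set k : ℂ → ℂ := fun t => g (q + R * Complex.exp (t.re * Complex.I)) - t.re * Complex.I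
    - Real.log R with hkdef
  have hk : Continuous k := by fun_prop
  have hk1 : ∀ t ∈ (univ : Set ℂ), Complex.exp (k t) = 1 := fun t _ => by
    have hRc : (R : ℂ) ≠ 0 := by exact_mod_cast hR.ne'
    rw [hkdef]
    simp only
    rw [Complex.exp_sub, Complex.exp_sub, h, Complex.ofReal_log hR.le, Complex.exp_log hRc]
    · have := Complex.exp_ne_zero (t.re * Complex.I)
      field_simp
      ring
    · simp [Complex.norm_exp, abs_of_pos hR]
  have h2 := eq_of_exp_eq_one isPreconnected_univ hk.continuousOn hk1 (mem_univ 0)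
    (mem_univ ((2 * Real.pi : ℝ) : ℂ))
  simp only [hkdef, Complex.ofReal_re, Complex.zero_re] at h2
  have h3 : Complex.exp (((2 * Real.pi : ℝ) : ℂ) * Complex.I) = 1 := by
    rw [Complex.ofReal_mul]
    exact_mod_cast Complex.exp_two_pi_mul_I
  rw [h3] at h2
  rw [eq_comm] at h2
  simp [sub_eq_self, Real.pi_ne_zero] at h2

/-- If `O` is a bounded set whose frontier lies in a closed set carrying a continuous
logarithm of `z - q`, then `q ∉ O`. -/
lemma HasContinuousLog.notMem_of_isBounded {O E : Set ℂ} {q : ℂ} (hE : IsClosed E)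
    (hOb : Bornology.IsBounded O) (hfr : frontier O ⊆ E)
    (h : HasContinuousLog E q) : q ∉ O := by
  classical
  intro hq
  obtain ⟨h, hh, hh'⟩ := h
  obtain ⟨H, hH⟩ := ContinuousMap.exists_restrict_eq hE ⟨E.domRestrict h, hh.domRestrict⟩
  have hH' : ∀ z ∈ E, H z = h z := fun z hz => congrArg (fun f => f ⟨z, hz⟩) hH
  set G : ℂ → ℂ := fun z => if z ∈ O then Complex.exp (H z) else z - q
  have hG : Continuous G := by
    refine continuous_if (fun z hz => ?_) (by fun_prop) (by fun_prop)
    rw [hH' z (hfr hz), hh' z (hfr hz)]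
  have hG0 : (0 : ℂ) ∉ G '' univ := by
    rintro ⟨z, -, hz⟩
    by_cases hzO : z ∈ O
    · simp [G, hzO] at hz
    · simp only [G, hzO, if_false, sub_eq_zero] at hz
      exact hzO (hz ▸ hq)
  have hsc : IsSimplyConnected (univ : Set ℂ) := by
    have := (convex_univ (𝕜 := ℝ) (E := ℂ)).contractibleSpace univ_nonempty
    exact inferInstanceAs (SimplyConnectedSpace (univ : Set ℂ))
  obtain ⟨g, hg, hgG⟩ := Complex.exists_continuousOn_eqOn_exp_comp hsc isOpen_univ
    hG.continuousOn hG0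
  obtain ⟨R, hR, hOR⟩ := hOb.subset_ball_lt 0 q
  refine not_exp_eq_on_sphere (q := q) hR (continuousOn_univ.1 hg) fun z hz => ?_
  have hzO : z ∉ O := fun h => by
    have := hOR h
    rw [Metric.mem_ball, dist_eq_norm] at this
    linarith
  have := hgG (mem_univ z)
  simpa [G, hzO] using this

/-- For an open closed map, connectedness of a full preimage can be tested on one fibre. -/
lemma IsPreconnected.preimage_of_fiber_subset {X Y : Type*} [TopologicalSpace X]
    [TopologicalSpace Y] {f : X → Y} (hfo : IsOpenMap f) (hfc : IsClosedMap f)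
    {S : Set Y} (hS : IsPreconnected S) {w : Y} (hw : w ∈ S) {T : Set X} (hT : IsPreconnected T)
    (hwT : f ⁻¹' {w} ⊆ T) (hTS : T ⊆ f ⁻¹' S) : IsPreconnected (f ⁻¹' S) := by
  have key : ∀ u v : Set X, IsOpen u → IsOpen v → f ⁻¹' S ⊆ u ∪ v → T ⊆ u →
      (f ⁻¹' S ∩ v).Nonempty → (f ⁻¹' S ∩ (u ∩ v)).Nonempty := by
    rintro u v hu hv huv hTu ⟨x, hxS, hxv⟩
    obtain ⟨s, hs, ⟨y, hyv, rfl⟩, hy⟩ := hS (f '' v) (f '' uᶜ)ᶜ (hfo v hv)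
      (hfc _ hu.isClosed_compl).isOpen_compl
      (fun s hs => by
        by_cases h : s ∈ f '' uᶜ
        · obtain ⟨y, hy, rfl⟩ := h
          exact Or.inl ⟨y, (huv hs).resolve_left hy, rfl⟩
        · exact Or.inr h)
      ⟨f x, hxS, x, hxv, rfl⟩
      ⟨w, hw, by rintro ⟨y, hy, rfl⟩; exact hy (hTu (hwT rfl))⟩
    refine ⟨y, hs, ?_, hyv⟩
    by_contra hyu
    exact hy ⟨y, hyu, rfl⟩
  intro u v hu hv huv hnu hnv
  by_contra hempty
  rw [Set.not_nonempty_iff_eq_empty] at hempty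
  have hTe : T ∩ (u ∩ v) = ∅ := by
    apply Set.eq_empty_of_subset_empty
    rw [← hempty]
    exact inter_subset_inter_left _ hTS
  rcases (isPreconnected_iff_subset_of_disjoint.1 hT) u v hu hv (hTS.trans huv) hTe with h | h
  · exact Set.not_nonempty_iff_eq_empty.2 hempty (key u v hu hv huv h hnv)
  · have := key v u hv hu (by rwa [union_comm]) h hnu
    rw [inter_comm v u] at this
    exact Set.not_nonempty_iff_eq_empty.2 hempty this

/-- Pulling back continuous logarithms along a proper open map of the plane. -/
lemma HasContinuousLog.preimage {f : ℂ → ℂ} (hf : Continuous f) (hfo : IsOpenMap f)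
    (hfp : IsProperMap f) {E : Set ℂ} (hE : IsCompact E) {a : ℂ} (ha : f a ∉ E)
    (h : HasContinuousLog E (f a)) : HasContinuousLog (f ⁻¹' E) a := by
  have hE' : IsCompact (f ⁻¹' E) := hfp.isCompact_preimage hE
  set Ω : Set ℂ := (f ⁻¹' E)ᶜ
  have hΩ : IsOpen Ω := hE'.isClosed.isOpen_compl
  set O := connectedComponentIn Ω a
  have haΩ : a ∈ Ω := ha
  have haO : a ∈ O := mem_connectedComponentIn haΩ
  have hO : IsOpen O := hΩ.connectedComponentIn
  have hOp : IsPreconnected O := isPreconnected_connectedComponentIn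
  have hOΩ : O ⊆ Ω := connectedComponentIn_subset Ω a
  have hcl : closure O ∩ Ω ⊆ O := by
    rintro z ⟨hz, hzΩ⟩
    have : IsPreconnected (insert z O) :=
      hOp.subset_closure (subset_insert z O) (insert_subset hz subset_closure)
    exact this.subset_connectedComponentIn (mem_insert_of_mem _ haO)
      (insert_subset hzΩ hOΩ) (mem_insert z O)
  have hunb : ¬ Bornology.IsBounded O := by
    intro hb
    have hcc : IsCompact (closure O) := hb.isCompact_closure
    have hcl' : closure (f '' O) ⊆ f '' closure O :=
      closure_minimal (image_mono subset_closure) (hcc.image hf).isClosed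
    refine h.notMem_of_isBounded hE.isClosed
      ((hcc.image hf).isBounded.subset (image_mono subset_closure)) ?_ (mem_image_of_mem f haO)
    rw [(hfo O hO).frontier_eq]
    rintro y ⟨hy, hyO⟩
    obtain ⟨z, hz, rfl⟩ := hcl' hy
    by_contra hzE
    exact hyO ⟨z, hcl ⟨hz, hzE⟩, rfl⟩
  obtain ⟨R, hR0, hR⟩ := hE'.isBounded.subset_ball_lt 0 0
  have : ¬ O ⊆ Metric.ball 0 R := fun h => hunb (Metric.isBounded_ball.subset h)
  obtain ⟨b, hbO, hb⟩ := not_subset.1 this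
  rw [Metric.mem_ball, dist_zero_right, not_lt] at hb
  have hbl : HasContinuousLog (f ⁻¹' E) b := HasContinuousLog.of_norm_lt (fun z hz => by
    have := hR hz
    rw [Metric.mem_ball, dist_zero_right] at this
    linarith) (norm_pos_iff.1 (by linarith))
  exact hbl.of_isPreconnected hE'.isClosed hOp
    (disjoint_left.2 fun z hz hz' => hOΩ hz' hz) hbO haO

lemma HasDerivAt.eventually_sign_of_neg {φ : ℝ → ℝ} {d : ℝ} (h : HasDerivAt φ d 0) (h0 : φ 0 = 0)
    (hd : d < 0) : (∀ᶠ t in 𝓝[>] 0, φ t < 0) ∧ ∀ᶠ t in 𝓝[<] 0, 0 < φ t := by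
  have h1 := (hasDerivAt_iff_tendsto_slope.1 h).eventually_lt_const hd
  have h2 : ∀ᶠ t in 𝓝[≠] (0 : ℝ), φ t / t < 0 := by
    filter_upwards [h1] with t ht
    simpa [slope_def_field, h0] using ht
  constructor
  · filter_upwards [h2.filter_mono (nhdsWithin_mono 0 fun t (ht : 0 < t) => ht.ne'),
      self_mem_nhdsWithin] with t ht ht0
    exact ((div_neg_iff.1 ht).resolve_left fun h => not_lt.2 (le_of_lt ht0) h.2).1
  · filter_upwards [h2.filter_mono (nhdsWithin_mono 0 fun t (ht : t < 0) => ht.ne),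
      self_mem_nhdsWithin] with t ht ht0
    exact ((div_neg_iff.1 ht).resolve_right fun h => not_lt.2 (le_of_lt ht0) h.2).1

/-- A set that crosses a short segment `[c - ε n, c + ε n]` exactly once, transversally, at `c`
and that stays connected when `c` is removed cannot carry continuous logarithms based at both
endpoints of the segment. -/
lemma not_isPreconnected_diff_of_crossing {E : Set ℂ} {c n : ℂ} {ε : ℝ} (hn : n ≠ 0) (hε : 0 < ε)
    (hc : c ∈ E) (ha : HasContinuousLog E (c + ε * n)) (hb : HasContinuousLog E (c - ε * n))
    (hseg : ∀ s : ℝ, |s| ≤ ε → c + s * n ∈ E → s = 0) {z : ℝ → ℂ} (hz0 : z 0 = c)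
    (hz : HasDerivAt z (-Complex.I * n) 0) (hzE : ∀ᶠ t in 𝓝 0, z t ∈ E) :
    ¬ IsPreconnected (E \ {c}) := by
  intro hM
  set a := c + ε * n with ha_def
  set b := c - ε * n with hb_def
  have hεc : (ε : ℂ) ≠ 0 := by exact_mod_cast hε.ne'
  obtain ⟨f, hf, hf'⟩ := ha
  obtain ⟨g, hg, hg'⟩ := hb
  set Q : ℂ → ℂ := fun w => (w - a) / (w - b) with hQ
  have hbE : ∀ w ∈ E, w - b ≠ 0 := fun w hw => hg' w hw ▸ Complex.exp_ne_zero _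
  have hslit : ∀ w ∈ E \ {c}, Q w ∈ Complex.slitPlane := by
    rintro w ⟨hwE, hwc⟩
    by_contra hns
    rw [Complex.mem_slitPlane_iff, not_or, not_lt, not_not] at hns
    obtain ⟨r, hr⟩ : ∃ r : ℝ, Q w = r := ⟨(Q w).re, Complex.ext rfl (by simpa using hns.2)⟩
    have hr0 : r ≤ 0 := by simpa [hr] using hns.1
    have h1r : (0 : ℝ) < 1 - r := by linarith
    have h1rc : (1 - r : ℂ) ≠ 0 := by exact_mod_cast h1r.ne'
    have hwa : w - a = r * (w - b) := by rw [← hr, hQ, div_mul_cancel₀ _ (hbE w hwE)]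
    have hw : w = c + ((ε * (1 + r) / (1 - r) : ℝ) : ℂ) * n := by
      push_cast
      field_simp
      rw [ha_def, hb_def] at hwa
      linear_combination hwa
    have hs := hseg (ε * (1 + r) / (1 - r)) (by
      rw [abs_le, div_le_iff₀ h1r, le_div_iff₀ h1r]
      constructor <;> nlinarith) (hw ▸ hwE)
    rw [hs] at hw
    exact hwc (by simpa using hw)
  have hconst : ∀ x ∈ E \ {c}, ∀ y ∈ E \ {c},
      f x - g x - Complex.log (Q x) = f y - g y - Complex.log (Q y) := by
    intro x hx y hy
    refine eq_of_exp_eq_one (k := fun w => f w - g w - Complex.log (Q w)) hM ?_ ?_ hx hy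
    · refine ((hf.mono sdiff_subset).sub (hg.mono sdiff_subset)).sub (ContinuousOn.clog ?_ hslit)
      exact ContinuousOn.div (by fun_prop) (by fun_prop) fun w hw => hbE w hw.1
    · intro w hw
      have h0 := Complex.slitPlane_ne_zero (hslit w hw)
      rw [Complex.exp_sub, Complex.exp_sub, Complex.exp_log h0, hf' w hw.1, hg' w hw.1]
      exact div_self h0
  have hcb : c - b ≠ 0 := hbE c hc
  have hQc : Q c = -1 := by
    rw [hQ]
    simp only
    rw [div_eq_iff hcb, ha_def, hb_def]
    ring
  have hQz : HasDerivAt (fun t => Q (z t)) (-2 * Complex.I / ε) 0 := by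
    have := (hz.sub_const a).div (hz.sub_const b) (by rw [hz0]; exact hcb)
    refine this.congr_deriv ?_
    rw [hz0, ha_def, hb_def]
    field_simp
    ring
  have him : HasDerivAt (fun t => (Q (z t)).im) (-2 / ε) 0 := by
    have := Complex.imCLM.hasFDerivAt.comp_hasDerivAt (0 : ℝ) hQz
    refine this.congr_deriv ?_
    rw [mul_div_right_comm]
    have : (-2 / (ε : ℂ)) = ((-2 / ε : ℝ) : ℂ) := by push_cast; ring
    rw [this]
    simp
  obtain ⟨hpos, hneg⟩ := him.eventually_sign_of_neg (by simp [hz0, hQc])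
    (div_neg_of_neg_of_pos (by norm_num) hε)
  have hQt : Tendsto (fun t => Q (z t)) (𝓝 0) (𝓝 (-1)) := by
    have := hQz.continuousAt.tendsto
    rwa [hz0, hQc] at this
  have hzt : Tendsto z (𝓝 0) (𝓝[E] c) :=
    tendsto_nhdsWithin_iff.2 ⟨hz0 ▸ hz.continuousAt.tendsto, hzE⟩
  have hfg : Tendsto (fun t => f (z t) - g (z t)) (𝓝 0) (𝓝 (f c - g c)) :=
    ((hf c hc).tendsto.comp hzt).sub ((hg c hc).tendsto.comp hzt)
  have hmem : ∀ t, z t ∈ E → (Q (z t)).im ≠ 0 → z t ∈ E \ {c} := fun t ht h =>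
    ⟨ht, fun h' => h (by rw [mem_singleton_iff.1 h', hQc]; simp)⟩
  have hposE : ∀ᶠ t in 𝓝[>] (0 : ℝ), z t ∈ E \ {c} := by
    filter_upwards [hpos, hzE.filter_mono nhdsWithin_le_nhds] with t h1 h2 using hmem t h2 h1.ne
  have hnegE : ∀ᶠ t in 𝓝[<] (0 : ℝ), z t ∈ E \ {c} := by
    filter_upwards [hneg, hzE.filter_mono nhdsWithin_le_nhds] with t h1 h2 using hmem t h2 h1.ne'
  have hlogpos : Tendsto (fun t => Complex.log (Q (z t))) (𝓝[>] 0) (𝓝 (-(Real.pi * Complex.I))) := by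
    have := (Complex.tendsto_log_nhdsWithin_im_neg_of_re_neg_of_im_zero (z := -1) (by simp)
      (by simp)).comp (tendsto_nhdsWithin_iff.2 ⟨hQt.mono_left nhdsWithin_le_nhds, hpos⟩)
    simpa using! this
  have hlogneg : Tendsto (fun t => Complex.log (Q (z t))) (𝓝[<] 0) (𝓝 (Real.pi * Complex.I)) := by
    have := (Complex.tendsto_log_nhdsWithin_im_nonneg_of_re_neg_of_im_zero (z := -1) (by simp)
      (by simp)).comp (tendsto_nhdsWithin_iff.2
        ⟨hQt.mono_left nhdsWithin_le_nhds, hneg.mono fun t ht => ht.le⟩)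
    simpa using! this
  obtain ⟨t₀, ht₀⟩ := hposE.exists
  have h1 : f c - g c - -(Real.pi * Complex.I) =
      f (z t₀) - g (z t₀) - Complex.log (Q (z t₀)) :=
    tendsto_nhds_unique ((hfg.mono_left nhdsWithin_le_nhds).sub hlogpos)
      (tendsto_const_nhds.congr' (hposE.mono fun t ht => hconst _ ht₀ _ ht))
  have h2 : f c - g c - Real.pi * Complex.I =
      f (z t₀) - g (z t₀) - Complex.log (Q (z t₀)) :=
    tendsto_nhds_unique ((hfg.mono_left nhdsWithin_le_nhds).sub hlogneg)
      (tendsto_const_nhds.congr' (hnegE.mono fun t ht => hconst _ ht₀ _ ht))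
  have h3 : (Real.pi : ℂ) * Complex.I = 0 := by linear_combination (h1 - h2) / 2
  simp [Real.pi_ne_zero] at h3

lemma IsPathConnected.exists_isCompact_isConnected_superset {X : Type*} [TopologicalSpace X]
    {U : Set X} (hU : IsPathConnected U) {F : Set X} (hF : F.Finite) (hF' : F.Nonempty)
    (hFU : F ⊆ U) : ∃ C, IsCompact C ∧ IsConnected C ∧ F ⊆ C ∧ C ⊆ U := by
  obtain ⟨x₀, hx₀⟩ := hF'
  choose γ hγ using fun x : F => hU.joinedIn x₀ (hFU hx₀) x (hFU x.2)
  have := hF.to_subtype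
  have : Nonempty F := ⟨⟨x₀, hx₀⟩⟩
  refine ⟨⋃ x : F, range (γ x), isCompact_iUnion fun x => isCompact_range (γ x).continuous,
    ⟨⟨x₀, mem_iUnion.2 ⟨⟨x₀, hx₀⟩, (γ _).source_mem_range⟩⟩, ?_⟩,
    fun x hx => mem_iUnion.2 ⟨⟨x, hx⟩, (γ _).target_mem_range⟩, ?_⟩
  · exact isPreconnected_iUnion ⟨x₀, mem_iInter.2 fun x => (γ x).source_mem_range⟩
      fun x => isPreconnected_range (γ x).continuous
  · exact iUnion_subset fun x => range_subset_iff.2 (hγ x)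

/-- The continuum in `A` over which the fibre of a point is joined. -/
lemma exists_continuum_of_isPathConnected_preimage {f : ℂ → ℂ} (hf : Continuous f) {A : Set ℂ}
    (hA : IsPathConnected (f ⁻¹' A)) {w : ℂ} (hw : w ∈ A) (hfin : (f ⁻¹' {w}).Finite)
    (hne : (f ⁻¹' {w}).Nonempty) :
    ∃ C T : Set ℂ, IsCompact C ∧ IsPreconnected C ∧ C ⊆ A ∧ w ∈ C ∧ IsPreconnected T ∧
      f ⁻¹' {w} ⊆ T ∧ T ⊆ f ⁻¹' C := by
  obtain ⟨T, hTc, hT, hFT, hTA⟩ := hA.exists_isCompact_isConnected_superset hfin hne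
    (preimage_mono (singleton_subset_iff.2 hw))
  refine ⟨f '' T, T, hTc.image hf, hT.isPreconnected.image f hf.continuousOn,
    image_subset_iff.2 hTA, ?_, hT.isPreconnected, hFT, subset_preimage_image f T⟩
  obtain ⟨x, hx⟩ := hne
  exact ⟨x, hFT hx, hx⟩

lemma hasContinuousLog_line_image {k u q : ℂ} (hu : u ≠ 0) (hq : ((q - k) / u).im ≠ 0) (s : Set ℝ) :
    HasContinuousLog ((fun t : ℝ => k + t * u) '' s) q := by
  refine HasContinuousLog.of_div_mem_slitPlane hu ?_
  rintro _ ⟨t, -, rfl⟩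
  have : (k + t * u - q) / u = t - (q - k) / u := by field_simp; ring
  rw [Complex.mem_slitPlane_iff]
  right
  rw [this]
  simpa using hq

lemma isPreconnected_line_image {s : Set ℝ} (hs : IsPreconnected s) (k u : ℂ) :
    IsPreconnected ((fun t : ℝ => k + t * u) '' s) :=
  hs.image _ (by fun_prop)

/-- The compact continuum obtained by joining `C₁` and `C₂` by the segment from `k` to `k + u`. -/
def bridge (C₁ C₂ : Set ℂ) (k u : ℂ) : Set ℂ :=
  C₁ ∪ (fun t : ℝ => k + t * u) '' Icc 0 1 ∪ C₂

lemma hasContinuousLog_bridge {C₁ C₂ : Set ℂ} {k u q : ℂ} (h₁ : IsClosed C₁) (h₂ : IsClosed C₂)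
    (hd : Disjoint C₁ C₂) (hu : u ≠ 0) (hk₁ : k ∈ C₁) (hk₂ : k + u ∈ C₂)
    (hC₁ : ∀ t ∈ Icc (0 : ℝ) 1, k + t * u ∈ C₁ → t = 0)
    (hC₂ : ∀ t ∈ Icc (0 : ℝ) 1, k + t * u ∈ C₂ → t = 1)
    (hq : ((q - k) / u).im ≠ 0) (hl₁ : HasContinuousLog C₁ q) (hl₂ : HasContinuousLog C₂ q) :
    HasContinuousLog (bridge C₁ C₂ k u) q := by
  have hseg : IsClosed ((fun t : ℝ => k + t * u) '' Icc 0 1) :=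
    (isCompact_Icc.image (by fun_prop)).isClosed
  refine HasContinuousLog.union (k := k + u) (h₁.union hseg) h₂ ?_
    (HasContinuousLog.union (k := k) h₁ hseg ?_ hl₁ (hasContinuousLog_line_image hu hq _)) hl₂
  · refine Subset.antisymm ?_ (singleton_subset_iff.2 ⟨Or.inr ⟨1, by simp, by simp⟩, hk₂⟩)
    rintro _ ⟨h | ⟨t, ht, rfl⟩, h2⟩
    · exact absurd h2 (disjoint_left.1 hd h)
    · simp [hC₂ t ht h2]
  · refine Subset.antisymm ?_ (singleton_subset_iff.2 ⟨hk₁, ⟨0, by simp, by simp⟩⟩)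
    rintro _ ⟨h1, ⟨t, ht, rfl⟩⟩
    simp [hC₁ t ht h1]

/-- Disjoint compact sets contain points joined by a segment that meets them only at its ends. -/
lemma exists_segment_of_disjoint {C₁ C₂ : Set ℂ} (h₁ : IsCompact C₁) (h₂ : IsCompact C₂)
    (hn₁ : C₁.Nonempty) (hn₂ : C₂.Nonempty) (hd : Disjoint C₁ C₂) :
    ∃ k u : ℂ, u ≠ 0 ∧ k ∈ C₁ ∧ k + u ∈ C₂ ∧
      (∀ t ∈ Icc (0 : ℝ) 1, k + t * u ∈ C₁ → t = 0) ∧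
      (∀ t ∈ Icc (0 : ℝ) 1, k + t * u ∈ C₂ → t = 1) := by
  obtain ⟨⟨k, l⟩, ⟨hk, hl⟩, hmin⟩ := (h₁.prod h₂).exists_isMinOn (hn₁.prod hn₂)
    (f := fun x : ℂ × ℂ => ‖x.2 - x.1‖) (by fun_prop)
  have hmin' : ∀ x ∈ C₁, ∀ y ∈ C₂, ‖l - k‖ ≤ ‖y - x‖ := fun x hx y hy => hmin (mk_mem_prod hx hy)
  have hu : l - k ≠ 0 := sub_ne_zero.2 fun h => disjoint_left.1 hd hk (h ▸ hl)
  have hpos := norm_pos_iff.2 hu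
  refine ⟨k, l - k, hu, hk, by simpa using hl, fun t ht h => ?_, fun t ht h => ?_⟩
  · have := hmin' _ h l hl
    rw [show l - (k + t * (l - k)) = ((1 - t : ℝ) : ℂ) * (l - k) by push_cast; ring, norm_mul,
      Complex.norm_real, Real.norm_eq_abs, abs_of_nonneg (by linarith [ht.2])] at this
    nlinarith [ht.1]
  · have := hmin' k hk _ h
    rw [show k + t * (l - k) - k = (t : ℂ) * (l - k) by ring, norm_mul,
      Complex.norm_real, Real.norm_eq_abs, abs_of_nonneg ht.1] at this
    nlinarith [ht.2]

lemma Polynomial.exists_two_preimages {p : ℂ[X]} (hp : 2 ≤ p.natDegree) {w : ℂ}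
    (hw : ∀ z, p.eval z = w → p.derivative.eval z ≠ 0) :
    ∃ c c' : ℂ, c ≠ c' ∧ p.eval c = w ∧ p.eval c' = w := by
  have hdeg : (p - C w).natDegree = p.natDegree := natDegree_sub_C
  obtain ⟨c, hc⟩ := IsAlgClosed.exists_root (p - C w) (by
    intro h
    have := natDegree_eq_zero_iff_degree_le_zero.2 h.le
    omega)
  obtain ⟨g, hg⟩ := dvd_iff_isRoot.2 hc
  have hp0 : p - C w ≠ 0 := fun h => by rw [h, natDegree_zero] at hdeg; omega
  have hg0 : g ≠ 0 := fun h => hp0 (by rw [hg, h, mul_zero])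
  have hgd : (p - C w).natDegree = 1 + g.natDegree := by
    rw [hg, natDegree_mul (X_sub_C_ne_zero c) hg0, natDegree_X_sub_C]
  obtain ⟨c', hc'⟩ := IsAlgClosed.exists_root g (by
    intro h
    have := natDegree_eq_zero_iff_degree_le_zero.2 h.le
    omega)
  have hpc : p.eval c = w := by simpa [sub_eq_zero] using hc
  have hpe : p = (X - C c) * g + C w := by rw [← hg]; ring
  refine ⟨c, c', ?_, hpc, ?_⟩
  · rintro rfl
    apply hw c hpc
    rw [hpe]
    simp [derivative_mul, hc'.eq_zero]
  · rw [hpe]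
    simp [hc'.eq_zero]

lemma Polynomial.isOpenMap_eval {p : ℂ[X]} (hp : 0 < p.natDegree) : IsOpenMap p.eval := by
  refine (AnalyticOnNhd.is_constant_or_isOpenMap (g := p.eval) ?_).resolve_left ?_
  · exact (p.differentiable.differentiableOn).analyticOnNhd isOpen_univ
  · rintro ⟨w, hw⟩
    have : p = C w := Polynomial.funext fun z => by simp [hw]
    rw [this, natDegree_C] at hp
    exact lt_irrefl _ hp

/-- Removing one of at least two points in a fibre over an interior point of the bridge does not
disconnect the preimage of the bridge. -/
lemma isPreconnected_preimage_bridge_diff {f : ℂ → ℂ} (hfo : IsOpenMap f) (hfc : IsClosedMap f)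
    {C₁ C₂ T₁ T₂ : Set ℂ} {k u w₁ w₂ c c' : ℂ} {t₀ : ℝ} (ht₀ : t₀ ∈ Ioo (0 : ℝ) 1)
    (hu : u ≠ 0) (hk₁ : k ∈ C₁) (hk₂ : k + u ∈ C₂)
    (hC₁ : ∀ t ∈ Icc (0 : ℝ) 1, k + t * u ∈ C₁ → t = 0)
    (hC₂ : ∀ t ∈ Icc (0 : ℝ) 1, k + t * u ∈ C₂ → t = 1)
    (h₁ : IsPreconnected C₁) (h₂ : IsPreconnected C₂)
    (hw₁ : w₁ ∈ C₁) (hw₂ : w₂ ∈ C₂) (hT₁ : IsPreconnected T₁) (hT₂ : IsPreconnected T₂)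
    (hwT₁ : f ⁻¹' {w₁} ⊆ T₁) (hwT₂ : f ⁻¹' {w₂} ⊆ T₂)
    (hTC₁ : T₁ ⊆ f ⁻¹' C₁) (hTC₂ : T₂ ⊆ f ⁻¹' C₂)
    (hcc : c ≠ c') (hc : f c = k + t₀ * u) (hc' : f c' = k + t₀ * u) :
    IsPreconnected (f ⁻¹' bridge C₁ C₂ k u \ {c}) := by
  set γ : ℝ → ℂ := fun t => k + t * u with hγ
  have hγc : Continuous γ := by fun_prop
  have hγi : ∀ s t, γ s = γ t → s = t := fun s t h => by
    have : (s : ℂ) * u = t * u := by simpa [hγ] using h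
    exact_mod_cast mul_right_cancel₀ hu this
  have h0m : (0 : ℝ) ∈ Ico 0 t₀ := ⟨le_rfl, ht₀.1⟩
  have h1m : (1 : ℝ) ∈ Ioc t₀ 1 := ⟨ht₀.2, le_rfl⟩
  have hS₁ : IsPreconnected (C₁ ∪ γ '' Ico 0 t₀) :=
    h₁.union k hk₁ ⟨0, h0m, by simp [hγ]⟩ (isPreconnected_line_image isPreconnected_Ico k u)
  have hS₂ : IsPreconnected (C₂ ∪ γ '' Ioc t₀ 1) :=
    h₂.union (k + u) hk₂ ⟨1, h1m, by simp [hγ]⟩ (isPreconnected_line_image isPreconnected_Ioc k u)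
  have hP₁ : IsPreconnected (f ⁻¹' (C₁ ∪ γ '' Ico 0 t₀)) :=
    hS₁.preimage_of_fiber_subset hfo hfc (Or.inl hw₁) hT₁ hwT₁
      (hTC₁.trans (preimage_mono subset_union_left))
  have hP₂ : IsPreconnected (f ⁻¹' (C₂ ∪ γ '' Ioc t₀ 1)) :=
    hS₂.preimage_of_fiber_subset hfo hfc (Or.inl hw₂) hT₂ hwT₂
      (hTC₂.trans (preimage_mono subset_union_left))
  have hcl₁ : γ t₀ ∈ closure (C₁ ∪ γ '' Ico 0 t₀) := by
    refine closure_mono subset_union_right (image_closure_subset_closure_image hγc ⟨t₀, ?_, rfl⟩)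
    rw [closure_Ico ht₀.1.ne]
    exact right_mem_Icc.2 ht₀.1.le
  have hcl₂ : γ t₀ ∈ closure (C₂ ∪ γ '' Ioc t₀ 1) := by
    refine closure_mono subset_union_right (image_closure_subset_closure_image hγc ⟨t₀, ?_, rfl⟩)
    rw [closure_Ioc ht₀.2.ne]
    exact left_mem_Icc.2 ht₀.2.le
  set F : Set ℂ := f ⁻¹' {γ t₀} \ {c} with hF
  have hFcl : ∀ S : Set ℂ, γ t₀ ∈ closure S → f ⁻¹' S ∪ F ⊆ closure (f ⁻¹' S) := fun S hS =>
    union_subset subset_closure fun z hz =>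
      hfo.preimage_closure_subset_closure_preimage (by
        have : f z = γ t₀ := hz.1
        rwa [mem_preimage, this])
  have hc'F : c' ∈ F := ⟨hc', fun h => hcc (mem_singleton_iff.1 h).symm⟩
  have hU := IsPreconnected.union c' (Or.inr hc'F) (Or.inr hc'F)
    (hP₁.subset_closure subset_union_left (hFcl _ hcl₁))
    (hP₂.subset_closure subset_union_left (hFcl _ hcl₂))
  convert hU using 1
  have hn₁ : γ t₀ ∉ C₁ := fun h => ht₀.1.ne' (hC₁ t₀ (Ioo_subset_Icc_self ht₀) h)
  have hn₂ : γ t₀ ∉ C₂ := fun h => ht₀.2.ne (hC₂ t₀ (Ioo_subset_Icc_self ht₀) h)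
  ext z
  constructor
  · rintro ⟨(h | ⟨t, ht, h⟩) | h, hz⟩
    · exact Or.inl (Or.inl (Or.inl h))
    · rcases lt_trichotomy t t₀ with h' | rfl | h'
      · exact Or.inl (Or.inl (Or.inr ⟨t, ⟨ht.1, h'⟩, h⟩))
      · exact Or.inl (Or.inr ⟨h.symm, hz⟩)
      · exact Or.inr (Or.inl (Or.inr ⟨t, ⟨h', ht.2⟩, h⟩))
    · exact Or.inr (Or.inl (Or.inl h))
  · have hne : ∀ {y}, f y ≠ γ t₀ → y ∉ ({c} : Set ℂ) := fun h h' =>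
      h (mem_singleton_iff.1 h' ▸ hc)
    rintro (((h | ⟨t, ht, h⟩) | h) | ((h | ⟨t, ht, h⟩) | h))
    · exact ⟨Or.inl (Or.inl h), hne fun h' => hn₁ (h' ▸ h)⟩
    · exact ⟨Or.inl (Or.inr ⟨t, ⟨ht.1, ht.2.le.trans ht₀.2.le⟩, h⟩),
        hne fun h' => ht.2.ne (hγi _ _ (h.trans h'))⟩
    · exact ⟨Or.inl (Or.inr ⟨t₀, Ioo_subset_Icc_self ht₀, h.1.symm⟩), h.2⟩
    · exact ⟨Or.inr h, hne fun h' => hn₂ (h' ▸ h)⟩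
    · exact ⟨Or.inl (Or.inr ⟨t, ⟨ht₀.1.le.trans ht.1.le, ht.2⟩, h⟩),
        hne fun h' => ht.1.ne' (hγi _ _ (h.trans h'))⟩
    · exact ⟨Or.inl (Or.inr ⟨t₀, Ioo_subset_Icc_self ht₀, h.1.symm⟩), h.2⟩

lemma hasContinuousLog_bridge_of_mem_ball {C₁ C₂ : Set ℂ} {k u q : ℂ} {t₀ δ : ℝ}
    (h₁ : IsClosed C₁) (h₂ : IsClosed C₂) (hd : Disjoint C₁ C₂) (ht₀ : t₀ ∈ Ioo (0 : ℝ) 1)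
    (hu : u ≠ 0) (hk₁ : k ∈ C₁) (hk₂ : k + u ∈ C₂)
    (hC₁ : ∀ t ∈ Icc (0 : ℝ) 1, k + t * u ∈ C₁ → t = 0)
    (hC₂ : ∀ t ∈ Icc (0 : ℝ) 1, k + t * u ∈ C₂ → t = 1)
    (hl₁ : HasContinuousLog C₁ (k + u)) (hl₂ : HasContinuousLog C₂ k)
    (hδ : Disjoint (C₁ ∪ C₂) (Metric.ball (k + t₀ * u) δ))
    (hqb : q ∈ Metric.ball (k + t₀ * u) δ) (hq : ((q - k) / u).im ≠ 0) :
    HasContinuousLog (bridge C₁ C₂ k u) q ∧ q ∉ bridge C₁ C₂ k u := by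
  rw [disjoint_union_left] at hδ
  have hδ0 : 0 < δ := Metric.pos_of_mem_ball hqb
  have hb : IsPreconnected (Metric.ball (k + t₀ * u) δ) := (convex_ball _ _).isPreconnected
  have hbc := Metric.mem_ball_self (x := k + t₀ * u) hδ0
  have hm : t₀ ∈ Icc t₀ 1 := left_mem_Icc.2 ht₀.2.le
  have hm' : t₀ ∈ Icc 0 t₀ := right_mem_Icc.2 ht₀.1.le
  refine ⟨hasContinuousLog_bridge h₁ h₂ hd hu hk₁ hk₂ hC₁ hC₂ hq ?_ ?_, ?_⟩
  · refine hl₁.of_isPreconnected h₁ (IsPreconnected.union (k + t₀ * u)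
      (mem_image_of_mem (fun t : ℝ => k + t * u) hm) hbc
      (isPreconnected_line_image isPreconnected_Icc k u) hb) (disjoint_union_right.2 ⟨?_, hδ.1⟩)
      (Or.inl ⟨1, right_mem_Icc.2 ht₀.2.le, by simp⟩) (Or.inr hqb)
    rw [disjoint_left]
    rintro _ h ⟨t, ht, rfl⟩
    have := hC₁ t ⟨ht₀.1.le.trans ht.1, ht.2⟩ h
    linarith [ht.1, ht₀.1]
  · refine hl₂.of_isPreconnected h₂ (IsPreconnected.union (k + t₀ * u)
      (mem_image_of_mem (fun t : ℝ => k + t * u) hm') hbc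
      (isPreconnected_line_image isPreconnected_Icc k u) hb) (disjoint_union_right.2 ⟨?_, hδ.2⟩)
      (Or.inl ⟨0, left_mem_Icc.2 ht₀.1.le, by simp⟩) (Or.inr hqb)
    rw [disjoint_left]
    rintro _ h ⟨t, ht, rfl⟩
    have := hC₂ t ⟨ht.1, ht.2.trans ht₀.2.le⟩ h
    linarith [ht.2, ht₀.2]
  · rintro ((h | ⟨t, -, rfl⟩) | h)
    · exact disjoint_left.1 hδ.1 h hqb
    · apply hq
      rw [add_sub_cancel_left, mul_div_cancel_right₀ _ hu, Complex.ofReal_im]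
    · exact disjoint_left.1 hδ.2 h hqb

/-- A holomorphic map leaves a line to first order along the direction transverse to it. -/
lemma HasDerivAt.eventually_im_ne_zero {f : ℂ → ℂ} {c D k u : ℂ} (hf : HasDerivAt f D c)
    (hD : D ≠ 0) (hu : u ≠ 0) :
    ∀ᶠ s : ℝ in 𝓝[≠] 0, ((f (c + s * (Complex.I * u / D)) - k) / u).im ≠ 0 := by
  set n := Complex.I * u / D with hn
  have h1 : HasDerivAt (fun s : ℂ => f (c + s * n)) (D * n) ((0 : ℝ) : ℂ) := by
    have hf' : HasDerivAt f D (c + ((0 : ℝ) : ℂ) * n) := by simpa using hf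
    have hl : HasDerivAt (fun s : ℂ => c + s * n) n ((0 : ℝ) : ℂ) := by
      simpa using ((hasDerivAt_id ((0 : ℝ) : ℂ)).mul_const n).const_add c
    exact HasDerivAt.comp (h := fun s : ℂ => c + s * n) _ hf' hl
  have h2 := ((h1.sub_const k).div_const u)
  have h3 : HasDerivAt (fun s : ℝ => ((f (c + s * n) - k) / u).im) 1 0 := by
    have h4 := h2.comp_ofReal
    have h5 := (Complex.imCLM.hasFDerivAt.comp_hasDerivAt (0 : ℝ) h4)
    have : D * n / u = Complex.I := by rw [hn]; field_simp
    rw [this] at h5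
    exact h5
  exact h3.eventually_ne one_ne_zero

lemma HasStrictDerivAt.exists_lift_line {f : ℂ → ℂ} {c D k u : ℂ} {t₀ : ℝ}
    (hf : HasStrictDerivAt f D c) (hD : D ≠ 0) (hc : f c = k + t₀ * u) :
    ∃ z : ℝ → ℂ, z 0 = c ∧ HasDerivAt z (D⁻¹ * u) 0 ∧
      ∀ᶠ t in 𝓝 0, f (z t) = k + ((t₀ + t : ℝ) : ℂ) * u := by
  have hl : HasDerivAt (fun s : ℂ => f c + s * u) u ((0 : ℝ) : ℂ) := by
    simpa using ((hasDerivAt_id ((0 : ℝ) : ℂ)).mul_const u).const_add (f c)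
  have hinv : HasDerivAt (hf.localInverse f D c hD) D⁻¹ (f c + ((0 : ℝ) : ℂ) * u) := by
    simpa using (hf.to_localInverse hD).hasDerivAt
  refine ⟨fun t => hf.localInverse f D c hD (f c + t * u), ?_, ?_, ?_⟩
  · simp [HasStrictDerivAt.localInverse, HasStrictFDerivAt.localInverse_apply_image]
  · exact (HasDerivAt.comp (h := fun s : ℂ => f c + s * u) _ hinv hl).comp_ofReal
  · have hr := hf.eventually_right_inverse hD
    have ht : Tendsto (fun t : ℝ => f c + t * u) (𝓝 0) (𝓝 (f c)) := by
      have : Continuous (fun t : ℝ => f c + t * u) := by fun_prop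
      simpa using this.tendsto 0
    filter_upwards [ht.eventually hr] with t ht
    rw [ht, hc]
    push_cast
    ring

lemma Polynomial.exists_mem_Ioo_not_critical {p : ℂ[X]} (hp : p.derivative ≠ 0) {k u : ℂ}
    (hu : u ≠ 0) : ∃ t ∈ Ioo (0 : ℝ) 1, ∀ z, p.eval z = k + t * u → p.derivative.eval z ≠ 0 := by
  have hinj : Function.Injective (fun t : ℝ => k + t * u) := fun s t h => by
    have : (s : ℂ) * u = t * u := by simpa using h
    exact_mod_cast mul_right_cancel₀ hu this
  have hfin : ((fun t : ℝ => k + t * u) ⁻¹' (p.eval '' {z | p.derivative.eval z = 0})).Finite :=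
    Finite.preimage hinj.injOn ((p.derivative.finite_setOfPred_isRoot hp).image _)
  obtain ⟨t, ht, htn⟩ := (Ioo_infinite (zero_lt_one' ℝ)).exists_notMem_finite hfin
  exact ⟨t, ht, fun z hz h0 => htn ⟨z, h0, hz⟩⟩

/-- Two disjoint simply connected open sets cannot both have path-connected preimages under a
polynomial of degree at least two. -/
theorem Polynomial.not_isPathConnected_preimage {p : ℂ[X]} (hp : 2 ≤ p.natDegree) {A B : Set ℂ}
    (hAo : IsOpen A) (hBo : IsOpen B) (hA : IsSimplyConnected A) (hB : IsSimplyConnected B)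
    (hAB : Disjoint A B) (hpA : IsPathConnected (p.eval ⁻¹' A)) :
    ¬ IsPathConnected (p.eval ⁻¹' B) := by
  intro hpB
  have hp0 : 0 < p.natDegree := by omega
  have hdeg : 0 < p.degree := natDegree_pos_iff_degree_pos.1 hp0
  have hfo : IsOpenMap p.eval := isOpenMap_eval hp0
  have hfp : IsProperMap p.eval := p.isProperMap_eval hdeg
  have hf : Continuous p.eval := p.continuous
  have hp' : p.derivative ≠ 0 := fun h => by
    have := derivative_eq_zero.1 h
    omega
  have hfin : ∀ w, (p.eval ⁻¹' {w}).Finite := fun w => by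
    have h0 : p - C w ≠ 0 := fun h => by
      have h1 : (p - C w).natDegree = p.natDegree := natDegree_sub_C
      rw [h, natDegree_zero] at h1
      omega
    convert (p - C w).finite_setOfPred_isRoot h0 using 1
    ext z
    simp [sub_eq_zero]
  obtain ⟨x₁, hx₁⟩ := hpA.nonempty
  obtain ⟨x₂, hx₂⟩ := hpB.nonempty
  obtain ⟨C₁, T₁, hC₁c, hC₁, hC₁A, hw₁, hT₁, hwT₁, hTC₁⟩ :=
    exists_continuum_of_isPathConnected_preimage hf hpA hx₁ (hfin _) ⟨x₁, rfl⟩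
  obtain ⟨C₂, T₂, hC₂c, hC₂, hC₂B, hw₂, hT₂, hwT₂, hTC₂⟩ :=
    exists_continuum_of_isPathConnected_preimage hf hpB hx₂ (hfin _) ⟨x₂, rfl⟩
  have hd : Disjoint C₁ C₂ := hAB.mono hC₁A hC₂B
  obtain ⟨k, u, hu, hk₁, hk₂, hi₁, hi₂⟩ :=
    exists_segment_of_disjoint hC₁c hC₂c ⟨_, hw₁⟩ ⟨_, hw₂⟩ hd
  obtain ⟨t₀, ht₀, hcrit⟩ := exists_mem_Ioo_not_critical hp' (k := k) hu
  obtain ⟨c, c', hcc, hc, hc'⟩ := exists_two_preimages hp hcrit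
  have hl₁ : HasContinuousLog C₁ (k + u) :=
    (HasContinuousLog.of_isSimplyConnected hA hAo
      (disjoint_right.1 hAB (hC₂B hk₂))).mono hC₁A
  have hl₂ : HasContinuousLog C₂ k :=
    (HasContinuousLog.of_isSimplyConnected hB hBo
      (disjoint_left.1 hAB (hC₁A hk₁))).mono hC₂B
  set D := p.derivative.eval c
  have hD : D ≠ 0 := hcrit c hc
  set n := Complex.I * u / D with hn
  have hn0 : n ≠ 0 := div_ne_zero (mul_ne_zero Complex.I_ne_zero hu) hD
  have hnot : k + t₀ * u ∈ (C₁ ∪ C₂)ᶜ := by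
    rintro (h | h)
    · exact ht₀.1.ne' (hi₁ t₀ (Ioo_subset_Icc_self ht₀) h)
    · exact ht₀.2.ne (hi₂ t₀ (Ioo_subset_Icc_self ht₀) h)
  obtain ⟨δ, hδ, hδC⟩ := Metric.isOpen_iff.1
    (hC₁c.union hC₂c).isClosed.isOpen_compl _ hnot
  have hev₁ := (p.hasDerivAt c).eventually_im_ne_zero (k := k) hD hu
  have hev₂ : ∀ᶠ s : ℝ in 𝓝 0, p.eval (c + s * n) ∈ Metric.ball (k + t₀ * u) δ := by
    have hcont : Continuous fun s : ℝ => p.eval (c + s * n) := by fun_prop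
    refine hcont.tendsto 0 (Metric.isOpen_ball.mem_nhds ?_)
    simpa [hc] using hδ
  obtain ⟨ε', hε', hball⟩ := Metric.eventually_nhds_iff.1
    ((eventually_nhdsWithin_iff.1 hev₁).and hev₂)
  have key : ∀ s : ℝ, |s| ≤ ε' / 2 → s ≠ 0 →
      HasContinuousLog (bridge C₁ C₂ k u) (p.eval (c + s * n)) ∧
        p.eval (c + s * n) ∉ bridge C₁ C₂ k u := fun s hs hs0 => by
    obtain ⟨h1, h2⟩ := hball (y := s) (by rw [Real.dist_eq, sub_zero]; linarith)
    exact hasContinuousLog_bridge_of_mem_ball hC₁c.isClosed hC₂c.isClosed hd ht₀ hu hk₁ hk₂ hi₁ hi₂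
      hl₁ hl₂ (disjoint_compl_right.mono_right hδC) h2 (h1 hs0)
  have hEc : IsCompact (bridge C₁ C₂ k u) :=
    (hC₁c.union (isCompact_Icc.image (by fun_prop))).union hC₂c
  have hseg : ∀ t ∈ Icc (0 : ℝ) 1, k + t * u ∈ bridge C₁ C₂ k u := fun t ht =>
    Or.inl (Or.inr ⟨t, ht, rfl⟩)
  have hlog : ∀ s : ℝ, |s| ≤ ε' / 2 → s ≠ 0 →
      HasContinuousLog (p.eval ⁻¹' bridge C₁ C₂ k u) (c + s * n) := fun s hs hs0 =>
    HasContinuousLog.preimage hf hfo hfp hEc (key s hs hs0).2 (key s hs hs0).1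
  have hε : 0 < ε' / 2 := half_pos hε'
  obtain ⟨z, hz0, hz, hzp⟩ := (p.hasStrictDerivAt c).exists_lift_line hD hc
  refine not_isPreconnected_diff_of_crossing (E := p.eval ⁻¹' bridge C₁ C₂ k u) hn0 hε ?_
    (hlog _ (abs_of_pos hε).le hε.ne') ?_ ?_ hz0 ?_ ?_
    (isPreconnected_preimage_bridge_diff hfo hfp.isClosedMap ht₀ hu hk₁ hk₂ hi₁ hi₂ hC₁ hC₂ hw₁ hw₂
      hT₁ hT₂ hwT₁ hwT₂ hTC₁ hTC₂ hcc hc hc')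
  · rw [mem_preimage, hc]
    exact hseg t₀ (Ioo_subset_Icc_self ht₀)
  · have := hlog (-(ε' / 2)) (by rw [abs_neg, abs_of_pos hε]) (neg_ne_zero.2 hε.ne')
    rwa [Complex.ofReal_neg, neg_mul, ← sub_eq_add_neg] at this
  · intro s hs hsE
    by_contra hs0
    exact (key s hs hs0).2 hsE
  · convert hz using 1
    rw [hn]
    linear_combination (-(u / D)) * Complex.I_mul_I
  · have hev₃ : ∀ᶠ t : ℝ in 𝓝 0, t₀ + t ∈ Icc (0 : ℝ) 1 := by
      have hcont : Continuous fun t : ℝ => t₀ + t := by fun_prop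
      exact hcont.tendsto 0 (by simpa using Icc_mem_nhds ht₀.1 ht₀.2)
    filter_upwards [hzp, hev₃] with t ht ht'
    rw [mem_preimage, ht]
    exact hseg _ ht'

end Helpers

/-- There do not exist: a complex polynomial `p` of degree `d ≥ 2`, an integer
`r ≥ 2`, pairwise disjoint nonempty bounded simply connected open sets
`V₁, …, V_r ⊆ ℂ`, and a permutation `σ` of `{1,…,r}` with `p⁻¹(V_{σ(j)}) = V_j`
for every `j`. -/
theorem stmt_13 :
    ¬ ∃ (p : Polynomial ℂ) (r : ℕ) (V : Fin r → Set ℂ) (σ : Equiv.Perm (Fin r)),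
      2 ≤ p.natDegree ∧ 2 ≤ r ∧
      (∀ j, (V j).Nonempty) ∧
      (∀ j, Bornology.IsBounded (V j)) ∧
      (∀ j, IsOpen (V j)) ∧
      (∀ j, SimplyConnectedSpace (V j)) ∧
      Pairwise (Function.onFun Disjoint V) ∧
      (∀ j, (fun z => p.eval z) ⁻¹' (V (σ j)) = V j) := by
  rintro ⟨p, r, V, σ, hp, hr, -, -, hVo, hV, hd, hpV⟩
  have hV' : ∀ j, IsSimplyConnected (V j) := fun j =>
    hV j
  have hpath : ∀ j, IsPathConnected (p.eval ⁻¹' V (σ j)) := fun j =>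
    (hpV j).symm ▸ (hV' j).isPathConnected
  have hne : σ ⟨0, by omega⟩ ≠ σ ⟨1, by omega⟩ := fun h => by simpa using σ.injective h
  exact p.not_isPathConnected_preimage hp (hVo _) (hVo _) (hV' _) (hV' _) (hd hne)
    (hpath _) (hpath _)
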